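/- Let p ≥ 2, k ≥ 1 and m ≥ 4 be integers, and let π : ℤ/p^{2k}ℤ → ℤ/p^{k}ℤ be the natural quotient homomorphism. Then there exists a continuous map φ : (ℤ/p^{2k}ℤ)^{*(m+1)} → (ℤ/p^{k}ℤ)^{*m} such that φ(ξ + c) = φ(ξ) + π(c) for every ξ ∈ (ℤ/p^{2k}ℤ)^{*(m+1)} and every c ∈ ℤ/p^{2k}ℤ, where + denotes the diagonal action. -/

import Mathlib

noncomputable section

/-- The equivalence relation defining the join `G^{*m}`: pairs `(t, g)` in
`Δ_{m-1} × G^m` are identified iff the simplex coordinates agree and the group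
coordinates agree at every index where the simplex coordinate is nonzero. -/
def JoinRel (G : Type*) [TopologicalSpace G] (m : ℕ) :
    (stdSimplex ℝ (Fin m) × (Fin m → G)) → (stdSimplex ℝ (Fin m) × (Fin m → G)) → Prop :=
  fun p q => p.1 = q.1 ∧ ∀ i, (p.1 : Fin m → ℝ) i ≠ 0 → p.2 i = q.2 i

/-- The `m`-fold join `G^{*m}`, with the quotient topology. -/
def Join (G : Type*) [TopologicalSpace G] (m : ℕ) : Type _ :=
  Quot (JoinRel G m)

instance (G : Type*) [TopologicalSpace G] (m : ℕ) : TopologicalSpace (Join G m) :=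
  inferInstanceAs (TopologicalSpace (Quot (JoinRel G m)))

/-- The diagonal action of `G` (written additively) on the join `G^{*m}`. -/
def Join.addAct {G : Type*} [TopologicalSpace G] [AddGroup G] {m : ℕ}
    (ξ : Join G m) (c : G) : Join G m :=
  Quot.map (fun p => (p.1, fun i => p.2 i + c))
    (fun _ _ h => ⟨h.1, fun i hi => by simp [h.2 i hi]⟩) ξ

section Helpers

open Complex

/-- A map into the join is continuous if its simplex coordinate is continuous and each group
coordinate is locally constant where the corresponding simplex coordinate is nonzero. -/
theorem Join.continuous_mk {X H : Type*} [TopologicalSpace X] [TopologicalSpace H] [Finite H]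
    {m : ℕ} (τ : X → stdSimplex ℝ (Fin m)) (hτ : Continuous τ) (h : X → Fin m → H)
    (hcl : ∀ i a, IsClosed {x | (τ x : Fin m → ℝ) i = 0 ∨ h x i = a}) :
    Continuous (fun x => (Quot.mk _ (τ x, h x) : Join H m)) := by
  refine LocallyFinite.continuous
    (f := fun a : Fin m → H => {x | ∀ i, (τ x : Fin m → ℝ) i = 0 ∨ h x i = a i})
    (locallyFinite_of_finite _) ?_ ?_ ?_
  · refine Set.eq_univ_of_forall fun x => Set.mem_iUnion.2 ⟨h x, fun i => Or.inr rfl⟩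
  · intro a
    simp only [Set.ofPred_forall]
    exact isClosed_iInter fun i => hcl i (a i)
  · intro a
    have hc : Continuous (fun x => (Quot.mk _ (τ x, a) : Join H m)) :=
      continuous_quot_mk.comp (hτ.prodMk continuous_const)
    refine hc.continuousOn.congr fun x hx => Quot.sound ⟨rfl, fun i hi => ?_⟩
    exact (hx i).resolve_left hi

/-- Rescale a nonnegative vector with positive sum to a point of the simplex. -/
def normalizeSimplex {m : ℕ} (α : Fin m → ℝ) (h0 : ∀ i, 0 ≤ α i) (h1 : 0 < ∑ i, α i) :
    stdSimplex ℝ (Fin m) :=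
  ⟨fun i => α i / ∑ j, α j, fun i => div_nonneg (h0 i) h1.le, by
    rw [← Finset.sum_div, div_self h1.ne']⟩

theorem normalizeSimplex_apply_eq_zero_iff {m : ℕ} {α : Fin m → ℝ} {h0 : ∀ i, 0 ≤ α i}
    {h1 : 0 < ∑ i, α i} {i : Fin m} :
    (normalizeSimplex α h0 h1 : Fin m → ℝ) i = 0 ↔ α i = 0 := by
  change α i / ∑ j, α j = 0 ↔ _
  simp [h1.ne']

theorem continuous_normalizeSimplex {X : Type*} [TopologicalSpace X] {m : ℕ}
    {α : X → Fin m → ℝ} (h0 : ∀ x i, 0 ≤ α x i) (h1 : ∀ x, 0 < ∑ i, α x i)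
    (hα : Continuous α) : Continuous fun x => normalizeSimplex (α x) (h0 x) (h1 x) := by
  refine Continuous.subtype_mk (continuous_pi fun i => ?_) _
  exact ((continuous_apply i).comp hα).div
    (continuous_finsetSum _ fun j _ => (continuous_apply j).comp hα) fun x => (h1 x).ne'

/-- A weight on `ℂ` that vanishes iff `z ^ n` is a nonpositive real. -/
def sectorWeight (n : ℕ) (z : ℂ) : ℝ := ‖z ^ n‖ + (z ^ n).re

theorem sectorWeight_nonneg (n : ℕ) (z : ℂ) : 0 ≤ sectorWeight n z := by
  have := abs_le.1 (abs_re_le_norm (z ^ n))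
  unfold sectorWeight
  linarith

theorem continuous_sectorWeight (n : ℕ) : Continuous (sectorWeight n) := by
  unfold sectorWeight
  fun_prop

theorem sectorWeight_ne_zero_iff {n : ℕ} {z : ℂ} :
    sectorWeight n z ≠ 0 ↔ z ^ n ∈ slitPlane := by
  rw [mem_slitPlane_iff_not_le_zero, ← re_eq_neg_norm, sectorWeight, add_comm,
    ne_eq, ← eq_neg_iff_add_eq_zero]

theorem sectorWeight_mul {n : ℕ} {ε z : ℂ} (hε : ε ^ n = 1) :
    sectorWeight n (ε * z) = sectorWeight n z := by
  rw [sectorWeight, mul_pow, hε, one_mul, sectorWeight]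

theorem stdAddChar_pow_self (n : ℕ) [NeZero n] (k : ZMod n) : ZMod.stdAddChar k ^ n = (1 : ℂ) := by
  rw [← AddChar.map_nsmul_eq_pow, nsmul_eq_mul, ZMod.natCast_self, zero_mul,
    AddChar.map_zero_eq_one]

theorem exists_stdAddChar_eq {n : ℕ} [NeZero n] {y : ℂ} (hy : y ^ n = 1) :
    ∃ k : ZMod n, ZMod.stdAddChar k = y := by
  obtain ⟨i, -, hi⟩ := (isPrimitiveRoot_exp n (NeZero.ne n)).eq_pow_of_pow_eq_one hy
  refine ⟨((i : ℤ) : ZMod n), ?_⟩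
  rw [ZMod.stdAddChar_coe, ← hi, ← Complex.exp_nat_mul]
  congr 1
  push_cast
  ring

/-- The index of the sector containing `z`: the `k` such that `z` is `exp (2πik/n)` times the
principal `n`-th root of `z ^ n`. -/
def sectorIndex (n : ℕ) [NeZero n] (z : ℂ) : ZMod n :=
  Classical.epsilon fun k => z = ZMod.stdAddChar k * (z ^ n) ^ (n : ℂ)⁻¹

theorem sectorIndex_spec {n : ℕ} [NeZero n] {z : ℂ} (hz : z ≠ 0) :
    z = ZMod.stdAddChar (sectorIndex n z) * (z ^ n) ^ (n : ℂ)⁻¹ := by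
  have hp := cpow_nat_inv_pow (z ^ n) (NeZero.ne n)
  have h0 : (z ^ n) ^ (n : ℂ)⁻¹ ≠ 0 := by
    intro h
    rw [h, zero_pow (NeZero.ne n)] at hp
    exact pow_ne_zero n hz hp.symm
  obtain ⟨k, hk⟩ : ∃ k : ZMod n, ZMod.stdAddChar k = z / (z ^ n) ^ (n : ℂ)⁻¹ :=
    exists_stdAddChar_eq (by rw [div_pow, hp, div_self (pow_ne_zero n hz)])
  exact Classical.epsilon_spec (p := fun k => z = ZMod.stdAddChar k * (z ^ n) ^ (n : ℂ)⁻¹)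
    ⟨k, by rw [hk, div_mul_cancel₀ _ h0]⟩

theorem sectorIndex_eq_iff {n : ℕ} [NeZero n] {z : ℂ} (hz : z ≠ 0) {k : ZMod n} :
    sectorIndex n z = k ↔ z = ZMod.stdAddChar k * (z ^ n) ^ (n : ℂ)⁻¹ := by
  refine ⟨fun h => h ▸ sectorIndex_spec hz, fun h => ?_⟩
  have h1 := (sectorIndex_spec (n := n) hz).symm.trans h
  refine ZMod.injective_stdAddChar (mul_right_cancel₀ (fun h0 => hz ?_) h1)
  rw [h, h0, mul_zero]

theorem sectorIndex_mul {n : ℕ} [NeZero n] {z : ℂ} (hz : z ≠ 0) (k : ZMod n) :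
    sectorIndex n (ZMod.stdAddChar k * z) = sectorIndex n z + k := by
  have hk : (ZMod.stdAddChar k : ℂ) ≠ 0 := fun h => by
    simpa [h, NeZero.ne n] using stdAddChar_pow_self n k
  rw [sectorIndex_eq_iff (mul_ne_zero hk hz), mul_pow, stdAddChar_pow_self, one_mul, add_comm,
    AddChar.map_add_eq_mul, mul_assoc, ← sectorIndex_spec hz]

theorem isClosed_sectorWeight_eq_zero_or (n : ℕ) [NeZero n] (a : ZMod n) :
    IsClosed {z | sectorWeight n z = 0 ∨ sectorIndex n z = a} := by
  have ho : IsOpen {z : ℂ | z ^ n ∈ slitPlane} := isOpen_slitPlane.preimage (continuous_pow n)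
  have hc : ContinuousOn (fun z : ℂ => z - ZMod.stdAddChar a * (z ^ n) ^ (n : ℂ)⁻¹)
      {z : ℂ | z ^ n ∈ slitPlane} :=
    continuousOn_id.sub (continuousOn_const.mul
      ((continuous_pow n).continuousOn.cpow_const fun z hz => hz))
  have := hc.isOpen_inter_preimage ho (isOpen_compl_singleton (x := (0 : ℂ)))
  rw [← isOpen_compl_iff]
  convert this using 1
  ext z
  simp only [Set.mem_compl_iff, Set.mem_ofPred_eq, not_or, Set.mem_inter_iff, Set.mem_preimage,
    Set.mem_singleton_iff, sub_eq_zero]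
  rw [← ne_eq, sectorWeight_ne_zero_iff]
  refine and_congr_right fun hz => not_congr (sectorIndex_eq_iff ?_)
  rintro rfl
  rw [zero_pow (NeZero.ne n)] at hz
  exact zero_notMem_slitPlane hz

/-- The components of the generalised Hopf map `(u, v) ↦ (u ^ n - v ^ n, v * conj u)`, the first
one being listed twice, the second time rotated by `d`. -/
def hopfCoord (n : ℕ) (d u v : ℂ) (i : ℕ) : ℂ :=
  if i = 0 then u ^ n - v ^ n else if i = 1 then d * (u ^ n - v ^ n) else v * starRingEnd ℂ u

theorem hopfCoord_mul {n : ℕ} {d u v ε : ℂ} (h1 : ‖ε‖ = 1) (hε : ε ^ (n * n) = 1) (i : ℕ) :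
    hopfCoord n d (ε * u) (ε ^ (n + 1) * v) i = ε ^ n * hopfCoord n d u v i := by
  have hv : (ε ^ (n + 1) * v) ^ n = ε ^ n * v ^ n := by
    rw [mul_pow, ← pow_mul, add_mul, pow_add, hε, one_mul, one_mul]
  have hc : ε * starRingEnd ℂ ε = 1 := by
    rw [mul_conj, normSq_eq_norm_sq, h1]
    norm_num
  unfold hopfCoord
  split_ifs
  · rw [hv, mul_pow, mul_sub]
  · rw [hv, mul_pow]
    ring
  · rw [map_mul, pow_succ]
    linear_combination ε ^ n * v * starRingEnd ℂ u * hc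

theorem eq_zero_of_sectorWeight_hopfCoord {n : ℕ} [NeZero n] {d u v : ℂ} (hd : d ^ n = -1)
    (h : ∀ i < 3, sectorWeight n (hopfCoord n d u v i) = 0) : u = 0 ∧ v = 0 := by
  have h0 := h 0 (by norm_num)
  have h1 := h 1 (by norm_num)
  have h2 := h 2 (by norm_num)
  simp only [hopfCoord, sectorWeight, if_true, one_ne_zero, if_false, mul_pow, hd, neg_mul, one_mul,
    norm_neg, neg_re, OfNat.ofNat_ne_zero, OfNat.ofNat_ne_one] at h0 h1 h2
  have huv : u ^ n = v ^ n := by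
    have : ‖(u ^ n - v ^ n) ^ n‖ = 0 := by linarith
    exact sub_eq_zero.1 (eq_zero_of_pow_eq_zero (norm_eq_zero.1 this))
  rw [← huv, ← map_pow, mul_conj, ofReal_re, norm_real, Real.norm_of_nonneg (normSq_nonneg _)] at h2
  have hu : u ^ n = 0 := normSq_eq_zero.1 (by linarith)
  exact ⟨eq_zero_of_pow_eq_zero hu, eq_zero_of_pow_eq_zero (huv ▸ hu)⟩

theorem eq_zero_of_rotated_combination {N : ℕ} {c x y : ℂ} (hc : c ^ N = I)
    (hx : x ^ N = 1) (hy : y ^ N = 1) {s t : ℝ} (h : s * x + c * (t * y) = 0) :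
    s = 0 ∧ t = 0 := by
  have h1 : (s * x : ℂ) ^ N = (-1) ^ N * (c * (t * y)) ^ N := by
    rw [eq_neg_of_add_eq_zero_left h, neg_pow]
  rw [mul_pow, mul_pow, mul_pow, hx, hy, hc, mul_one, mul_one] at h1
  have h2 : ((s ^ N : ℝ) : ℂ) = (((-1) ^ N * t ^ N : ℝ) : ℂ) * I := by
    push_cast
    rw [h1]
    ring
  have him := congrArg Complex.im h2
  have hre := congrArg Complex.re h2
  simp only [ofReal_im, ofReal_re, re_ofReal_mul, im_ofReal_mul, I_re, I_im, mul_zero,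
    mul_one] at him hre
  refine ⟨eq_zero_of_pow_eq_zero hre, eq_zero_of_pow_eq_zero (n := N) ?_⟩
  simpa using him.symm

theorem stdAddChar_pow_eq {n N : ℕ} [NeZero n] [NeZero N] (hN : N = n * n)
    (h : n ∣ N) (a : ZMod N) :
    (ZMod.stdAddChar a : ℂ) ^ n = ZMod.stdAddChar (ZMod.castHom h (ZMod n) a) := by
  obtain ⟨j, rfl⟩ : ∃ j : ℤ, (j : ZMod N) = a := ZMod.intCast_surjective a
  have hn : (n : ℂ) ≠ 0 := Nat.cast_ne_zero.2 (NeZero.ne n)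
  rw [map_intCast (ZMod.castHom h (ZMod n)), ZMod.stdAddChar_coe, ZMod.stdAddChar_coe, ← Complex.exp_nat_mul, hN]
  congr 1
  push_cast
  field_simp

section EquivariantMap

variable {n N : ℕ} (r : ℕ) (π : ZMod N →+* ZMod n) (ψ : AddChar (ZMod N) ℂ)
  (c d : ℂ)

/-- The first two join coordinates, mapped to the complex plane. -/
def joinFst (x : stdSimplex ℝ (Fin (r + 3 + 1)) × (Fin (r + 3 + 1) → ZMod N)) : ℂ :=
  (x.1 0 : ℝ) * ψ (x.2 0) + c * ((x.1 1 : ℝ) * ψ (x.2 1))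

/-- The third and fourth join coordinates, mapped to the complex plane. -/
def joinSnd (x : stdSimplex ℝ (Fin (r + 3 + 1)) × (Fin (r + 3 + 1) → ZMod N)) : ℂ :=
  (x.1 2 : ℝ) * ψ (x.2 2) ^ (n + 1) + c * ((x.1 3 : ℝ) * ψ (x.2 3) ^ (n + 1))

/-- The complex coordinates feeding the first three simplex coordinates of the image. -/
def joinHopf (x : stdSimplex ℝ (Fin (r + 3 + 1)) × (Fin (r + 3 + 1) → ZMod N)) (i : ℕ) : ℂ :=
  hopfCoord n d (joinFst r ψ c x) (joinSnd (n := n) r ψ c x) i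

/-- The unnormalised simplex coordinates of the image. -/
def joinWeight (x : stdSimplex ℝ (Fin (r + 3 + 1)) × (Fin (r + 3 + 1) → ZMod N))
    (i : Fin (r + 3)) : ℝ :=
  if (i : ℕ) < 3 then sectorWeight n (joinHopf (n := n) r ψ c d x i) else x.1 i.succ

theorem continuous_joinHopf (i : ℕ) : Continuous fun x => joinHopf (n := n) r ψ c d x i := by
  have ht (j) : Continuous fun x : stdSimplex ℝ (Fin (r + 3 + 1)) × (Fin (r + 3 + 1) → ZMod N) =>
      (((x.1 j : ℝ)) : ℂ) :=
    continuous_ofReal.comp ((continuous_apply j).comp (continuous_subtype_val.comp continuous_fst))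
  have hg (j) : Continuous fun x : stdSimplex ℝ (Fin (r + 3 + 1)) × (Fin (r + 3 + 1) → ZMod N) =>
      ψ (x.2 j) :=
    continuous_of_discreteTopology.comp ((continuous_apply j).comp continuous_snd)
  have hu : Continuous (joinFst r ψ c) :=
    ((ht 0).mul (hg 0)).add (continuous_const.mul ((ht 1).mul (hg 1)))
  have hv : Continuous (joinSnd (n := n) r ψ c) :=
    ((ht 2).mul ((hg 2).pow _)).add (continuous_const.mul ((ht 3).mul ((hg 3).pow _)))
  unfold joinHopf hopfCoord
  split_ifs
  · exact (hu.pow n).sub (hv.pow n)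
  · exact continuous_const.mul ((hu.pow n).sub (hv.pow n))
  · exact hv.mul (continuous_conj.comp hu)

theorem continuous_joinWeight : Continuous (joinWeight (n := n) r ψ c d) := by
  refine continuous_pi fun i => ?_
  unfold joinWeight
  split_ifs
  · exact (continuous_sectorWeight n).comp (continuous_joinHopf r ψ c d i)
  · exact (continuous_apply _).comp (continuous_subtype_val.comp continuous_fst)

theorem joinWeight_nonneg (x : stdSimplex ℝ (Fin (r + 3 + 1)) × (Fin (r + 3 + 1) → ZMod N))
    (i : Fin (r + 3)) : 0 ≤ joinWeight (n := n) r ψ c d x i := by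
  unfold joinWeight
  split_ifs
  · exact sectorWeight_nonneg _ _
  · exact x.1.2.1 _

variable {r ψ c d} in
theorem joinHopf_congr {x y : stdSimplex ℝ (Fin (r + 3 + 1)) × (Fin (r + 3 + 1) → ZMod N)}
    (h : JoinRel (ZMod N) (r + 3 + 1) x y) :
    joinHopf (n := n) r ψ c d x = joinHopf (n := n) r ψ c d y := by
  obtain ⟨t, g⟩ := x
  obtain ⟨t', g'⟩ := y
  obtain ⟨rfl, h⟩ := h
  have key (f : ZMod N → ℂ) (j) : ((t j : ℝ) : ℂ) * f (g j) = (t j : ℝ) * f (g' j) := by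
    by_cases hj : t j = 0
    · simp [hj]
    · rw [show g j = g' j from h j hj]
  funext i
  unfold joinHopf joinFst joinSnd
  simp only [key ψ, key fun a => ψ a ^ (n + 1)]

variable [NeZero n]

/-- The group coordinates of the image. -/
def joinIndex (x : stdSimplex ℝ (Fin (r + 3 + 1)) × (Fin (r + 3 + 1) → ZMod N))
    (i : Fin (r + 3)) : ZMod n :=
  if (i : ℕ) < 3 then sectorIndex n (joinHopf (n := n) r ψ c d x i) else π (x.2 i.succ)

theorem isClosed_joinWeight_eq_zero_or (i : Fin (r + 3)) (a : ZMod n) :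
    IsClosed {x | joinWeight (n := n) r ψ c d x i = 0 ∨ joinIndex r π ψ c d x i = a} := by
  unfold joinWeight joinIndex
  split_ifs
  · exact (isClosed_sectorWeight_eq_zero_or n a).preimage (continuous_joinHopf r ψ c d i)
  · refine IsClosed.union ?_ ?_
    · have ht : Continuous fun x : stdSimplex ℝ (Fin (r + 3 + 1)) × (Fin (r + 3 + 1) → ZMod N) =>
          (x.1 i.succ : ℝ) :=
        (continuous_apply _).comp (continuous_subtype_val.comp continuous_fst)
      exact isClosed_eq ht continuous_const
    · have hg : Continuous fun x : stdSimplex ℝ (Fin (r + 3 + 1)) × (Fin (r + 3 + 1) → ZMod N) =>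
          x.2 i.succ := (continuous_apply _).comp continuous_snd
      exact (isClosed_discrete {b | π b = a}).preimage hg

variable {r π ψ c d}

theorem sum_joinWeight_pos (hc : c ^ N = I) (hd : d ^ n = -1) (hψ : ∀ a, ψ a ^ N = 1)
    (x : stdSimplex ℝ (Fin (r + 3 + 1)) × (Fin (r + 3 + 1) → ZMod N)) :
    0 < ∑ i, joinWeight (n := n) r ψ c d x i := by
  have hnn := joinWeight_nonneg (n := n) r ψ c d x
  refine (Finset.sum_nonneg fun i _ => hnn i).lt_of_ne' fun h => ?_
  have hz (i) : joinWeight (n := n) r ψ c d x i = 0 :=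
    (Finset.sum_eq_zero_iff_of_nonneg fun i _ => hnn i).1 h i (Finset.mem_univ i)
  obtain ⟨hu, hv⟩ := eq_zero_of_sectorWeight_hopfCoord (u := joinFst r ψ c x)
    (v := joinSnd (n := n) r ψ c x) hd fun i hi => by
      simpa [joinWeight, hi, joinHopf] using hz ⟨i, by omega⟩
  have hψ' (a) : (ψ a ^ (n + 1)) ^ N = 1 := by rw [pow_right_comm, hψ, one_pow]
  obtain ⟨h0, h1⟩ := eq_zero_of_rotated_combination hc (hψ _) (hψ _) hu
  obtain ⟨h2, h3⟩ := eq_zero_of_rotated_combination hc (hψ' _) (hψ' _) hv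
  have hall (j : Fin (r + 3 + 1)) : x.1 j = 0 := by
    obtain ⟨j, hj⟩ := j
    match j, hj with
    | 0, _ => exact h0
    | 1, _ => exact h1
    | 2, _ => exact h2
    | 3, _ => exact h3
    | j + 4, hj => exact (if_neg (by simp)).symm.trans (hz ⟨j + 3, by omega⟩)
  have hsum : ∑ j, x.1 j = 1 := x.1.2.2
  simp [hall] at hsum

variable [NeZero N]

theorem joinHopf_add (hπ : ∀ a, ψ a ^ n = ZMod.stdAddChar (π a))
    (x : stdSimplex ℝ (Fin (r + 3 + 1)) × (Fin (r + 3 + 1) → ZMod N)) (b : ZMod N) (i : ℕ) :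
    joinHopf (n := n) r ψ c d (x.1, fun j => x.2 j + b) i =
      ZMod.stdAddChar (π b) * joinHopf (n := n) r ψ c d x i := by
  have hb : ψ b ^ (n * n) = 1 := by rw [pow_mul, hπ, stdAddChar_pow_self]
  rw [← hπ, joinHopf, joinHopf, ← hopfCoord_mul (AddChar.norm_apply ψ b) hb]
  congr 1
  · simp only [joinFst, AddChar.map_add_eq_mul]
    ring
  · simp only [joinSnd, AddChar.map_add_eq_mul, mul_pow]
    ring

variable (r) in
theorem exists_continuous_join_equivariant (π : ZMod N →+* ZMod n) (ψ : AddChar (ZMod N) ℂ)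
    (hπ : ∀ a, ψ a ^ n = ZMod.stdAddChar (π a)) :
    ∃ φ : Join (ZMod N) (r + 3 + 1) → Join (ZMod n) (r + 3),
      Continuous φ ∧ ∀ (ξ : Join (ZMod N) (r + 3 + 1)) (b : ZMod N),
        φ (Join.addAct ξ b) = Join.addAct (φ ξ) (π b) := by
  obtain ⟨c, hc⟩ := IsAlgClosed.exists_pow_nat_eq I (NeZero.pos N)
  obtain ⟨d, hd⟩ := IsAlgClosed.exists_pow_nat_eq (-1 : ℂ) (NeZero.pos n)
  have hψ (a) : ψ a ^ N = 1 := by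
    rw [← AddChar.map_nsmul_eq_pow, nsmul_eq_mul, ZMod.natCast_self, zero_mul,
      AddChar.map_zero_eq_one]
  have hpos := sum_joinWeight_pos (r := r) hc hd hψ
  let τ (x : stdSimplex ℝ (Fin (r + 3 + 1)) × (Fin (r + 3 + 1) → ZMod N)) :=
    normalizeSimplex (joinWeight (n := n) r ψ c d x) (joinWeight_nonneg r ψ c d x) (hpos x)
  have hτ {x y} (h : joinWeight (n := n) r ψ c d x = joinWeight (n := n) r ψ c d y) :
      τ x = τ y := by
    simp only [τ, h]
  have hne {x : stdSimplex ℝ (Fin (r + 3 + 1)) × (Fin (r + 3 + 1) → ZMod N)} {i : Fin (r + 3)}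
      (hi : (τ x : Fin (r + 3) → ℝ) i ≠ 0) : joinWeight (n := n) r ψ c d x i ≠ 0 :=
    fun h => hi (normalizeSimplex_apply_eq_zero_iff.2 h)
  have hrel {x y} (h : JoinRel (ZMod N) (r + 3 + 1) x y) :
      (Quot.mk _ (τ x, joinIndex r π ψ c d x) : Join (ZMod n) (r + 3)) =
        Quot.mk _ (τ y, joinIndex r π ψ c d y) := by
    have hH := joinHopf_congr (n := n) (ψ := ψ) (c := c) (d := d) h
    refine Quot.sound ⟨hτ ?_, fun i hi => ?_⟩
    · funext i
      simp only [joinWeight, hH, h.1]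
    · have hw := hne hi
      simp only [joinIndex, joinWeight, hH] at hw ⊢
      split_ifs with h3
      · rfl
      · rw [if_neg h3] at hw
        rw [h.2 _ hw]
  refine ⟨Quot.lift (fun x => Quot.mk _ (τ x, joinIndex r π ψ c d x)) fun x y h => hrel h, ?_, ?_⟩
  · refine continuous_quot_lift _ (Join.continuous_mk τ ?_ _ fun i a => ?_)
    · exact continuous_normalizeSimplex _ _ (continuous_joinWeight r ψ c d)
    · simp only [τ, normalizeSimplex_apply_eq_zero_iff]
      exact isClosed_joinWeight_eq_zero_or r π ψ c d i a
  · rintro ⟨x⟩ b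
    refine Quot.sound ⟨hτ ?_, fun i hi => ?_⟩
    · funext i
      simp only [joinWeight, joinHopf_add hπ, sectorWeight_mul (stdAddChar_pow_self n (π b))]
    · have hw := hne hi
      simp only [joinIndex, joinWeight, joinHopf_add hπ, map_add] at hw ⊢
      split_ifs with h3
      · rw [if_pos h3, sectorWeight_mul (stdAddChar_pow_self n (π b)),
          sectorWeight_ne_zero_iff] at hw
        refine sectorIndex_mul (fun h0 => ?_) _
        rw [h0, zero_pow (NeZero.ne n)] at hw
        exact zero_notMem_slitPlane hw
      · rfl

end EquivariantMap

end Helpers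

theorem stmt0 (p k m : ℕ) (hp : 2 ≤ p) (hk : 1 ≤ k) (hm : 4 ≤ m) :
    ∃ φ : Join (ZMod (p ^ (2 * k))) (m + 1) → Join (ZMod (p ^ k)) m,
      Continuous φ ∧
      ∀ (ξ : Join (ZMod (p ^ (2 * k))) (m + 1)) (c : ZMod (p ^ (2 * k))),
        φ (Join.addAct ξ c) =
          Join.addAct (φ ξ)
            (ZMod.castHom (pow_dvd_pow p (by omega : k ≤ 2 * k)) (ZMod (p ^ k)) c) := by
  obtain ⟨r, rfl⟩ : ∃ r, m = r + 3 := ⟨m - 3, by omega⟩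
  have : NeZero p := ⟨by omega⟩
  exact exists_continuous_join_equivariant r
    (ZMod.castHom (pow_dvd_pow p (by omega : k ≤ 2 * k)) (ZMod (p ^ k))) ZMod.stdAddChar
    (stdAddChar_pow_eq (by rw [two_mul, pow_add]) _)
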